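/- arXiv:2203.05887 — 10 statements merged into one kernel-verified Lean document; each statement's English description precedes it below -/
import Mathlib

section
/- Let G be a finite simple graph, let k be an integer, and let v_1, …, v_h be h distinct vertices of G each of degree at least h. Then G has a vertex cover of size at most k if and only if either (1) G − {v_1, …, v_h} has a vertex cover of size at most k − h, or (2) there exists i ∈ {1, …, h} such that G − N(v_i) has a vertex cover of size at most k − deg(v_i). (Here G − S denotes the induced subgraph on V(G) ∖ S and N(v) the set of neighbors of v.) -/
/-- `G` minus the vertex set `S` has a vertex cover of size at most `k` (with `k : ℤ`):
there is a set `W` of vertices, disjoint from `S`, of size at most `k`, covering every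
edge of `G` whose endpoints both avoid `S`. -/
def HasVCofDel {V : Type*} [Fintype V] [DecidableEq V] (G : SimpleGraph V)
    (S : Finset V) (k : ℤ) : Prop :=
  ∃ W : Finset V, (W.card : ℤ) ≤ k ∧ (∀ x ∈ W, x ∉ S) ∧
    ∀ ⦃u v : V⦄, G.Adj u v → u ∉ S → v ∉ S → u ∈ W ∨ v ∈ W

/-- Adding the deleted set to a cover of the rest gives a cover of the whole graph. -/
theorem HasVCofDel.to_empty {V : Type*} [Fintype V] [DecidableEq V] {G : SimpleGraph V}
    {S : Finset V} {k : ℤ} (hS : HasVCofDel G S (k - S.card)) : HasVCofDel G ∅ k := by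
  obtain ⟨W, hW, -, hc⟩ := hS
  refine ⟨W ∪ S, ?_, by simp, ?_⟩
  · have := Finset.card_union_le W S
    omega
  · intro a b hab _ _
    have := hc hab
    simp only [Finset.mem_union]
    tauto

/-- Removing a subset of the cover leaves a cover of the remaining graph. -/
theorem HasVCofDel.of_subset {V : Type*} [Fintype V] [DecidableEq V] {G : SimpleGraph V}
    {S W : Finset V} {k : ℤ} (hW : (W.card : ℤ) ≤ k) (hS : S ⊆ W)
    (hc : ∀ ⦃a b : V⦄, G.Adj a b → a ∈ W ∨ b ∈ W) : HasVCofDel G S (k - S.card) := by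
  refine ⟨W \ S, ?_, by simp, ?_⟩
  · have := Finset.card_sdiff_add_card_eq_card hS
    omega
  · intro a b hab ha hb
    have := hc hab
    simp only [Finset.mem_sdiff]
    tauto

/-- Correctness of the branching step for Vertex Cover above h-Index:
given `h` distinct vertices `v 0, …, v (h-1)`, each of degree at least `h`,
`G` has a vertex cover of size at most `k` iff either `G − {v 0, …, v (h-1)}` has a
vertex cover of size at most `k − h`, or for some `i` the graph `G − N(v i)` has a
vertex cover of size at most `k − deg (v i)`. -/
theorem vertexCover_above_hIndex_branching {V : Type*} [Fintype V] [DecidableEq V]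
    (G : SimpleGraph V) [DecidableRel G.Adj] (k : ℤ) (h : ℕ)
    (v : Fin h → V) (hinj : Function.Injective v)
    (hdeg : ∀ i : Fin h, h ≤ G.degree (v i)) :
    HasVCofDel G ∅ k ↔
      (HasVCofDel G (Finset.univ.image v) (k - h) ∨
        ∃ i : Fin h, HasVCofDel G (G.neighborFinset (v i)) (k - G.degree (v i))) := by
  have hcard : (Finset.univ.image v).card = h := by
    rw [Finset.card_image_of_injective _ hinj]; simp
  constructor
  · rintro ⟨W, hW, -, hc⟩
    have hc' : ∀ ⦃a b : V⦄, G.Adj a b → a ∈ W ∨ b ∈ W := fun a b hab =>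
      hc hab (by simp) (by simp)
    by_cases hall : ∀ i, v i ∈ W
    · left
      have := HasVCofDel.of_subset (S := Finset.univ.image v) hW
        (by intro x hx; obtain ⟨i, -, rfl⟩ := Finset.mem_image.1 hx; exact hall i) hc'
      rwa [hcard] at this
    · right
      push Not at hall
      obtain ⟨i, hi⟩ := hall
      refine ⟨i, ?_⟩
      have := HasVCofDel.of_subset (S := G.neighborFinset (v i)) hW
        (by intro x hx; exact (hc' ((G.mem_neighborFinset _ _).1 hx)).resolve_left hi) hc'
      rwa [G.card_neighborFinset_eq_degree] at this
  · rintro (h1 | ⟨i, h2⟩)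
    · exact HasVCofDel.to_empty (S := Finset.univ.image v) (by rwa [hcard])
    · exact HasVCofDel.to_empty (S := G.neighborFinset (v i))
        (by rwa [G.card_neighborFinset_eq_degree])
end

section
/- Let G be a finite simple graph, let k be an integer, and let V′ ⊆ V(G) be a nonempty set of vertices. Then G has a feedback vertex set of size at most k if and only if one of the following holds: (1) G − V′ has a feedback vertex set of size at most k − |V′|; (2) there exists u ∈ V′ such that G − N_{G[V′]}(u) has a feedback vertex set of size at most k − deg_{G[V′]}(u); or (3) there exist u ∈ V′ and v ∈ N_{G[V′]}(u) such that G − (N_{G[V′]}(u) ∖ {v}) has a feedback vertex set of size at most k − deg_{G[V′]}(u) + 1. (Here G[V′] denotes the subgraph induced by V′, N_{G[V′]}(u) the neighborhood of u in G[V′], and deg_{G[V′]}(u) its degree in G[V′].) -/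
/-- `G` minus the vertex set `S` has a feedback vertex set of size at most `k`
(with `k : ℤ`): there is a set `X` of vertices, disjoint from `S`, of size at most `k`,
such that deleting `S ∪ X` from `G` leaves an acyclic graph. -/
def HasFVSofDel {V : Type*} [Fintype V] [DecidableEq V] (G : SimpleGraph V)
    (S : Finset V) (k : ℤ) : Prop :=
  ∃ X : Finset V, (X.card : ℤ) ≤ k ∧ (∀ x ∈ X, x ∉ S) ∧
    (G.induce {w : V | w ∉ S ∧ w ∉ X}).IsAcyclic

theorem acyclic_exists_leaf {W : Type*} [Finite W] [Nonempty W] (H : SimpleGraph W)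
    (h : H.IsAcyclic) : ∃ u, ∀ v w, H.Adj u v → H.Adj u w → v = w := by
  classical
  haveI := Fintype.ofFinite W
  let P : ℕ → Prop := fun n => ∃ (a b : W) (p : H.Walk a b), p.IsPath ∧ p.length = n
  have hP0 : P 0 := by
    obtain ⟨a⟩ := ‹Nonempty W›
    exact ⟨a, a, .nil, by simp, rfl⟩
  have hb : ∀ n, P n → n ≤ Fintype.card W := by
    rintro n ⟨a, b, p, hp, rfl⟩
    exact hp.length_lt.le
  obtain ⟨a, b, p, hp, hl⟩ := Nat.findGreatest_spec (P := P) (Nat.zero_le (Fintype.card W)) hP0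
  have key : ∀ v, H.Adj a v → v ∈ p.support := by
    intro v hv
    by_contra hn
    have h1 : P (p.length + 1) :=
      ⟨v, b, .cons hv.symm p, (SimpleGraph.Walk.cons_isPath_iff _ _).2 ⟨hp, hn⟩, by simp⟩
    have := Nat.le_findGreatest (hb _ h1) h1
    omega
  refine ⟨a, fun v w hv hw => ?_⟩
  rw [h.eq_snd_of_adj_start hp hv (key v hv), h.eq_snd_of_adj_start hp hw (key w hw)]

theorem fvs_of_subset {V : Type*} [Fintype V] [DecidableEq V] (G : SimpleGraph V)
    (S X : Finset V) (k j : ℤ) (hX : (X.card : ℤ) ≤ k)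
    (hA : (G.induce {w : V | w ∉ (∅ : Finset V) ∧ w ∉ X}).IsAcyclic) (hS : S ⊆ X)
    (hj : j = k - S.card) :
    HasFVSofDel G S j := by
  refine ⟨X \ S, ?_, by simp, ?_⟩
  · have := Finset.card_sdiff_add_card_eq_card hS
    omega
  · have : {w : V | w ∉ S ∧ w ∉ X \ S} = {w : V | w ∉ (∅ : Finset V) ∧ w ∉ X} := by
      ext w
      have := @hS w
      simp
      tauto
    rw [this]; exact hA

theorem fvs_of_del {V : Type*} [Fintype V] [DecidableEq V] (G : SimpleGraph V)
    (S : Finset V) (k j : ℤ) (h : HasFVSofDel G S j) (hj : j = k - S.card) :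
    HasFVSofDel G ∅ k := by
  obtain ⟨X, hX, _, hA⟩ := h
  refine ⟨S ∪ X, ?_, by simp, ?_⟩
  · have := Finset.card_union_le S X
    omega
  · have : {w : V | w ∉ (∅ : Finset V) ∧ w ∉ S ∪ X} = {w : V | w ∉ S ∧ w ∉ X} := by
      ext w
      simp
    rw [this]; exact hA

/-- Correctness of the branching step for Feedback Vertex Set above Degeneracy:
for a nonempty vertex set `V'`, the graph `G` has a feedback vertex set of size at
most `k` iff (1) `G − V'` has a feedback vertex set of size at most `k − |V'|`, or
(2) for some `u ∈ V'`, the graph `G − N_{G[V']}(u)` has a feedback vertex set of size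
at most `k − deg_{G[V']}(u)`, or (3) for some `u ∈ V'` and a neighbor `w` of `u` in
`G[V']`, the graph `G − (N_{G[V']}(u) ∖ {w})` has a feedback vertex set of size at most
`k − deg_{G[V']}(u) + 1`. -/
theorem feedbackVertexSet_above_degeneracy_branching {V : Type*} [Fintype V]
    [DecidableEq V] (G : SimpleGraph V) [DecidableRel G.Adj] (k : ℤ)
    (V' : Finset V) (hV' : V'.Nonempty) :
    HasFVSofDel G ∅ k ↔
      (HasFVSofDel G V' (k - V'.card) ∨
        (∃ u ∈ V', HasFVSofDel G (V'.filter (fun w => G.Adj u w))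
          (k - (V'.filter (fun w => G.Adj u w)).card)) ∨
        (∃ u ∈ V', ∃ w ∈ V'.filter (fun w => G.Adj u w),
          HasFVSofDel G ((V'.filter (fun w => G.Adj u w)).erase w)
            (k - (V'.filter (fun w => G.Adj u w)).card + 1))) := by
  constructor
  · rintro ⟨X, hX, -, hA⟩
    by_cases hs : V' ⊆ X
    · exact Or.inl (fvs_of_subset G V' X k _ hX hA hs rfl)
    right
    obtain ⟨a, ha, haX⟩ := Finset.not_subset.1 hs
    let U : Set V := {w | w ∈ V' ∧ w ∉ X}
    have hU : (G.induce U).IsAcyclic := by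
      have hle : U ⊆ {w : V | w ∉ (∅ : Finset V) ∧ w ∉ X} := fun w hw => ⟨by simp, hw.2⟩
      exact hA.embedding (SimpleGraph.induceHomOfLE G hle)
    haveI : Nonempty U := ⟨⟨a, ha, haX⟩⟩
    obtain ⟨⟨u, hu, huX⟩, hleaf⟩ := acyclic_exists_leaf _ hU
    by_cases hN : V'.filter (fun w => G.Adj u w) ⊆ X
    · exact Or.inl ⟨u, hu, fvs_of_subset G _ X k _ hX hA hN rfl⟩
    right
    obtain ⟨w, hw, hwX⟩ := Finset.not_subset.1 hN
    refine ⟨u, hu, w, hw, fvs_of_subset G _ X k _ hX hA ?_ ?_⟩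
    · intro z hz
      obtain ⟨hzw, hz⟩ := Finset.mem_erase.1 hz
      rw [Finset.mem_filter] at hz hw
      by_contra hzX
      exact hzw (congrArg Subtype.val
        (hleaf ⟨z, hz.1, hzX⟩ ⟨w, hw.1, hwX⟩ hz.2 hw.2))
    · have := Finset.card_erase_add_one hw
      omega
  · rintro (h | ⟨u, hu, h⟩ | ⟨u, hu, w, hw, h⟩)
    · exact fvs_of_del G _ k _ h rfl
    · exact fvs_of_del G _ k _ h rfl
    · refine fvs_of_del G _ k _ h ?_
      have := Finset.card_erase_add_one hw
      omega
end

section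
/- Let G be a finite simple graph and let G′ be obtained from G by adding, for each edge e = {u, v} ∈ E(G), a new vertex w_e adjacent exactly to u and v. Then for every integer ℓ, G′ has a feedback vertex set of size at most ℓ if and only if G has a vertex cover of size at most ℓ. -/
/-- The graph `G'` obtained from `G` by adding, for each edge `e = {u,v}` of `G`, a new
vertex `w_e` adjacent exactly to `u` and `v`. -/
def triangleExtension {V : Type*} (G : SimpleGraph V) : SimpleGraph (V ⊕ G.edgeSet) :=
  SimpleGraph.fromRel (fun a b =>
    match a, b with
    | Sum.inl u, Sum.inl v => G.Adj u v
    | Sum.inl u, Sum.inr e => u ∈ (e : Sym2 V)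
    | Sum.inr e, Sum.inl u => u ∈ (e : Sym2 V)
    | Sum.inr _, Sum.inr _ => False)


theorem acyclic_of_leaf {U : Type*} (H : SimpleGraph U)
    (h : ∀ a b, H.Adj a b → (∀ x y, H.Adj a x → H.Adj a y → x = y) ∨
      (∀ x y, H.Adj b x → H.Adj b y → x = y)) : H.IsAcyclic := by
  classical
  have key : ∀ a (c : H.Walk a a), c.IsCycle → ¬ (∀ x y, H.Adj a x → H.Adj a y → x = y) := by
    intro a c hc hh
    exact hc.snd_ne_penultimate (hh _ _ (c.adj_snd hc.not_nil) (c.adj_penultimate hc.not_nil).symm)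
  intro a c hc
  rcases h _ _ (c.adj_snd hc.not_nil) with h1 | h1
  · exact key a c hc h1
  · have hm : c.snd ∈ c.support := c.getVert_mem_support 1
    exact key _ _ (hc.rotate hm) h1

theorem triangleExtension_fvs_iff_vc {V : Type*} [Fintype V] [DecidableEq V]
    (G : SimpleGraph V) [DecidableRel G.Adj] (ℓ : ℕ) :
    (∃ X : Finset (V ⊕ G.edgeSet), X.card ≤ ℓ ∧
        ((triangleExtension G).induce {x | x ∉ X}).IsAcyclic) ↔
      (∃ W : Finset V, W.card ≤ ℓ ∧ ∀ ⦃u v : V⦄, G.Adj u v → u ∈ W ∨ v ∈ W) := by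
  constructor
  · rintro ⟨X, hX, hac⟩
    let f : V ⊕ G.edgeSet → V := fun x => match x with
      | Sum.inl v => v
      | Sum.inr e => (e : Sym2 V).out.1
    refine ⟨X.image f, Finset.card_image_le.trans hX, ?_⟩
    intro u v huv
    by_contra hcon
    push Not at hcon
    obtain ⟨hu, hv⟩ := hcon
    have hu' : Sum.inl u ∉ X := fun h => hu (Finset.mem_image_of_mem f h)
    have hv' : Sum.inl v ∉ X := fun h => hv (Finset.mem_image_of_mem f h)
    let e : G.edgeSet := ⟨s(u, v), huv⟩
    have he' : Sum.inr e ∉ X := by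
      intro h
      have h1 := Finset.mem_image_of_mem f h
      have h2 : f (Sum.inr e) ∈ s(u, v) := Sym2.out_fst_mem (s(u, v))
      rcases Sym2.mem_iff.1 h2 with h3 | h3
      · exact hu (h3 ▸ h1)
      · exact hv (h3 ▸ h1)
    let a : {x | x ∉ X} := ⟨Sum.inl u, hu'⟩
    let b : {x | x ∉ X} := ⟨Sum.inl v, hv'⟩
    let c : {x | x ∉ X} := ⟨Sum.inr e, he'⟩
    have hab : ((triangleExtension G).induce {x | x ∉ X}).Adj a b := by
      simp [triangleExtension, a, b, huv, huv.ne]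
    have hbc : ((triangleExtension G).induce {x | x ∉ X}).Adj b c := by
      simp [triangleExtension, b, c, e]
    have hca : ((triangleExtension G).induce {x | x ∉ X}).Adj c a := by
      simp [triangleExtension, a, c, e]
    refine hac (SimpleGraph.Walk.cons hab (.cons hbc (.cons hca .nil))) ?_
    have := hab.ne
    have := hbc.ne
    have := hca.ne
    simp [SimpleGraph.Walk.cons_isCycle_iff, SimpleGraph.Walk.cons_isPath_iff]
    grind
  · rintro ⟨W, hW, hc⟩
    refine ⟨W.map ⟨Sum.inl, Sum.inl_injective⟩, by simpa using hW, ?_⟩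
    have leaf : ∀ (e : G.edgeSet) (u v : V), u ∉ W → v ∉ W → u ∈ (e : Sym2 V) →
        v ∈ (e : Sym2 V) → u = v := by
      rintro ⟨e, he⟩ u v hu hv hue hve
      by_contra hne
      have := (Sym2.mem_and_mem_iff hne).1 ⟨hue, hve⟩
      subst this
      rcases hc he with h | h
      · exact hu h
      · exact hv h
    have leaf2 : ∀ (e : G.edgeSet) (he : Sum.inr e ∈
        {x | x ∉ W.map ⟨Sum.inl, Sum.inl_injective⟩}) x y,
        ((triangleExtension G).induce _).Adj ⟨Sum.inr e, he⟩ x →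
        ((triangleExtension G).induce _).Adj ⟨Sum.inr e, he⟩ y → x = y := by
      rintro e he ⟨x | x, hx⟩ ⟨y | y, hy⟩ h1 h2 <;> simp [triangleExtension] at h1 h2 hx hy ⊢
      exact leaf e x y hx hy h1 h2
    apply acyclic_of_leaf
    rintro ⟨a | a, ha⟩ ⟨b | b, hb⟩ hab
    · exfalso
      simp [triangleExtension] at ha hb hab
      rcases hab.2 with h | h <;> rcases hc h with h | h <;> contradiction
    · exact Or.inr (leaf2 b hb)
    · exact Or.inl (leaf2 a ha)
    · exact Or.inl (leaf2 a ha)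
end

section
/- In the construction below, the minimum size of a set D ⊆ V(G′) such that G′ − D contains no clique on r vertices is exactly n·k; moreover, D = V_1 ∪ ⋯ ∪ V_k is such a minimum set. -/
/-- Vertices of the construction: `W`-vertices `w^i_j` (`Sum.inl`), then the clique
vertices `A_i` and their pendant leaves, then the `k+1` cliques `B` and their pendant
leaves. -/
abbrev ISVert (n k r : ℕ) :=
  (Fin k × Fin n) ⊕
    ((Fin k × Fin (r - 2)) ⊕ (Fin k × Fin (r - 2))) ⊕
      ((Fin (k + 1) × Fin (r - 1)) ⊕ (Fin (k + 1) × Fin (r - 1)))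

/-- Base relation of the construction (symmetrized by `SimpleGraph.fromRel`):
each `V_i = {w^i_j : j}` is a clique; `w^i_q ~ w^j_q` for `i ≠ j`; `w^i_p ~ w^i_q`
for edges `{p,q}` of `G`; each `A_i` is a clique joined completely to `V_i`, with a
pendant leaf on each of its vertices; each of the `k+1` cliques of `B` is joined
completely to all `V_i`'s, with a pendant leaf on each of its vertices. -/
def isRel (n k r : ℕ) (G : SimpleGraph (Fin n)) :
    ISVert n k r → ISVert n k r → Prop
  | Sum.inl (i, p), Sum.inl (i', p') =>
      (i = i') ∨ (i ≠ i' ∧ p = p') ∨ (i = i' ∧ G.Adj p p')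
  | Sum.inl (i, _), Sum.inr (Sum.inl (Sum.inl (i', _))) => i = i'
  | Sum.inl _, Sum.inr (Sum.inr (Sum.inl _)) => True
  | Sum.inr (Sum.inl (Sum.inl (i, _))), Sum.inr (Sum.inl (Sum.inl (i', _))) => i = i'
  | Sum.inr (Sum.inl (Sum.inl (i, a))), Sum.inr (Sum.inl (Sum.inr (i', a'))) =>
      i = i' ∧ a = a'
  | Sum.inr (Sum.inr (Sum.inl (c, _))), Sum.inr (Sum.inr (Sum.inl (c', _))) => c = c'
  | Sum.inr (Sum.inr (Sum.inl (c, b))), Sum.inr (Sum.inr (Sum.inr (c', b'))) =>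
      c = c' ∧ b = b'
  | _, _ => False

/-- The graph `G'` of the construction. -/
def isGraph (n k r : ℕ) (G : SimpleGraph (Fin n)) : SimpleGraph (ISVert n k r) :=
  SimpleGraph.fromRel (isRel n k r G)

/-- `D` is a deletion set to `K_r`-freeness: after removing `D`, the graph contains no
clique on `r` vertices. -/
def IsKrFreeDeletion {α : Type*} (H : SimpleGraph α) (r : ℕ) (D : Finset α) : Prop :=
  ¬ ∃ s : Finset α, H.IsNClique r s ∧ ∀ x ∈ s, x ∉ D

/-- A colouring of the graph with the `W`-vertices removed. -/
def isCol (n k r : ℕ) : ISVert n k r → ℕ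
  | Sum.inl _ => 0
  | Sum.inr (Sum.inl (Sum.inl (_, a))) => a.val
  | Sum.inr (Sum.inl (Sum.inr (_, a))) => if a.val = 0 then 1 else 0
  | Sum.inr (Sum.inr (Sum.inl (_, a))) => a.val
  | Sum.inr (Sum.inr (Sum.inr (_, a))) => if a.val = 0 then 1 else 0

lemma isCol_lt {n k r : ℕ} (hr : 3 ≤ r) (x : ISVert n k r) : isCol n k r x < r - 1 := by
  rcases x with _ | ((⟨_, a⟩ | ⟨_, a⟩) | (⟨_, a⟩ | ⟨_, a⟩)) <;> simp only [isCol] <;>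
    (try split_ifs) <;> (try have := a.isLt) <;> omega

lemma isCol_ne {n k r : ℕ} (G : SimpleGraph (Fin n)) (x y)
    (h : (isGraph n k r G).Adj (Sum.inr x) (Sum.inr y)) :
    isCol n k r (Sum.inr x) ≠ isCol n k r (Sum.inr y) := by
  rw [isGraph, SimpleGraph.fromRel_adj] at h
  obtain ⟨hne, h⟩ := h
  rcases x with ((⟨i, a⟩ | ⟨i, a⟩) | (⟨i, a⟩ | ⟨i, a⟩)) <;>
  rcases y with ((⟨j, b⟩ | ⟨j, b⟩) | (⟨j, b⟩ | ⟨j, b⟩)) <;>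
  simp only [isCol, isRel, or_self, or_false, false_or] at h hne ⊢ <;> grind

lemma isGraph_card_le {n k r : ℕ} (G : SimpleGraph (Fin n))
    (D : Finset (ISVert n k r)) (hD : IsKrFreeDeletion (isGraph n k r G) r D)
    (i : Fin k) (c : Fin (k + 1)) (hr : 3 ≤ r) :
    n ≤ (Finset.univ.filter fun p : Fin n => (Sum.inl (i, p) : ISVert n k r) ∈ D).card +
      (Finset.univ.filter fun b : Fin (r - 1) =>
        (Sum.inr (Sum.inr (Sum.inl (c, b))) : ISVert n k r) ∈ D).card := by
  by_contra hcon
  apply hD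
  set S := Finset.univ.filter fun p : Fin n => (Sum.inl (i, p) : ISVert n k r) ∉ D with hS
  set T := Finset.univ.filter fun b : Fin (r - 1) =>
        (Sum.inr (Sum.inr (Sum.inl (c, b))) : ISVert n k r) ∉ D with hT
  have h1 := Finset.card_filter_add_card_filter_not (s := (Finset.univ : Finset (Fin n)))
    (fun p : Fin n => (Sum.inl (i, p) : ISVert n k r) ∈ D)
  have h2 := Finset.card_filter_add_card_filter_not (s := (Finset.univ : Finset (Fin (r - 1))))
    (fun b : Fin (r - 1) => (Sum.inr (Sum.inr (Sum.inl (c, b))) : ISVert n k r) ∈ D)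
  rw [Finset.card_univ, Fintype.card_fin] at h1 h2
  rw [← hS] at h1
  rw [← hT] at h2
  let f : Fin n ⊕ Fin (r - 1) → ISVert n k r
    | Sum.inl p => Sum.inl (i, p)
    | Sum.inr b => Sum.inr (Sum.inr (Sum.inl (c, b)))
  have hf : Function.Injective f := by
    rintro (x | x) (y | y) h <;> simp_all [f]
  have hcard : r ≤ ((S.disjSum T).image f).card := by
    rw [Finset.card_image_of_injective _ hf, Finset.card_disjSum]
    omega
  obtain ⟨t, ht, htc⟩ := Finset.exists_subset_card_eq hcard
  refine ⟨t, ⟨?_, htc⟩, ?_⟩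
  · intro x hx y hy hxy
    have hx' := ht hx
    have hy' := ht hy
    simp only [Finset.mem_image] at hx' hy'
    obtain ⟨x, -, rfl⟩ := hx'
    obtain ⟨y, -, rfl⟩ := hy'
    rw [isGraph, SimpleGraph.fromRel_adj]
    refine ⟨hxy, ?_⟩
    rcases x with x | x <;> rcases y with y | y <;> simp [f, isRel]
  · intro x hx
    have hx' := ht hx
    simp only [Finset.mem_image] at hx'
    obtain ⟨x, hx2, rfl⟩ := hx'
    rcases x with x | x <;> simpa [f, hS, hT] using hx2

/-- The minimum size of a set `D` whose removal makes `G'` `K_r`-free is exactly `n·k`;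
moreover `D = V_1 ∪ ⋯ ∪ V_k` (the set of all `W`-vertices) is such a minimum set. -/
theorem isGraph_distance_to_KrFree {n k r : ℕ} (hr : 3 ≤ r) (hk : 1 ≤ k)
    (G : SimpleGraph (Fin n)) :
    IsKrFreeDeletion (isGraph n k r G) r
        ((Finset.univ : Finset (Fin k × Fin n)).image Sum.inl) ∧
      ((Finset.univ : Finset (Fin k × Fin n)).image
        (Sum.inl : Fin k × Fin n → ISVert n k r)).card = n * k ∧
      ∀ D : Finset (ISVert n k r), IsKrFreeDeletion (isGraph n k r G) r D →
        n * k ≤ D.card := by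
  refine ⟨?_, ?_, ?_⟩
  · rintro ⟨s, hs, hsD⟩
    have hmap : s.card ≤ (Finset.range (r - 1)).card := by
      apply Finset.card_le_card_of_injOn (isCol n k r)
      · intro x _
        simpa using isCol_lt hr x
      · intro x hx y hy hxy
        by_contra hne
        have hadj := hs.1 hx hy hne
        have h1 := hsD x hx
        have h2 := hsD y hy
        rcases x with x | x
        · simp at h1
        rcases y with y | y
        · simp at h2
        exact isCol_ne G x y hadj hxy
    rw [hs.2, Finset.card_range] at hmap
    omega
  · rw [Finset.card_image_of_injective _ Sum.inl_injective]
    simp [mul_comm]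
  · intro D hD
    let f : Fin k → ℕ := fun i =>
      (Finset.univ.filter fun p : Fin n => (Sum.inl (i, p) : ISVert n k r) ∈ D).card
    let g : Fin (k + 1) → ℕ := fun c => (Finset.univ.filter fun b : Fin (r - 1) =>
        (Sum.inr (Sum.inr (Sum.inl (c, b))) : ISVert n k r) ∈ D).card
    have key : ∀ i c, n ≤ f i + g c := fun i c => isGraph_card_le G D hD i c hr
    have h1 : n * k ≤ ∑ i, f i + ∑ c, g c := by
      calc n * k = ∑ _i : Fin k, n := by simp [mul_comm]
        _ ≤ ∑ i : Fin k, (f i + g i.castSucc) := Finset.sum_le_sum fun i _ => key i _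
        _ = ∑ i, f i + ∑ i : Fin k, g i.castSucc := Finset.sum_add_distrib
        _ ≤ _ := by rw [Fin.sum_univ_castSucc g]; omega
    have hA : ∑ i, f i = D.toLeft.card := by
      rw [← Finset.filter_univ_mem D.toLeft, Finset.card_filter, Fintype.sum_prod_type]
      simp [f]
    have hB : ∑ c, g c = D.toRight.toRight.toLeft.card := by
      rw [← Finset.filter_univ_mem D.toRight.toRight.toLeft, Finset.card_filter,
        Fintype.sum_prod_type]
      simp [g]
    have e1 := D.card_toLeft_add_card_toRight
    have e2 := D.toRight.card_toLeft_add_card_toRight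
    have e3 := D.toRight.toRight.card_toLeft_add_card_toRight
    omega
end

section
/- Let G be the graph produced by the SAT construction below and let X be a minimum cluster deletion set of G. Then for each i ∈ {1, …, m}, X contains all vertices of exactly two of the three sides of the clause gadget for C_i and none of the vertices of the third side. -/
/-- Vertices of the SAT construction: clause-gadget vertices `u_{r,s,i}`
(`Sum.inl (r, s, i)` with `r : Fin 3`, `s : Fin 7`, `i : Fin m`) and variable-gadget
vertices `v_{b,s,j}` (`Sum.inr (b, s, j)` with `b : Bool`, `s : Fin 3`, `j : Fin n`),
where side `b = true` plays the role of side `1` (positive literal `x_j`) and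
`b = false` the role of side `2` (negative literal `¬x_j`). -/
abbrev SatVert (m n : ℕ) := (Fin 3 × Fin 7 × Fin m) ⊕ (Bool × Fin 3 × Fin n)

/-- Base relation of the SAT construction, symmetrized by `SimpleGraph.fromRel`.
The formula is given by `L : Fin m → Fin 3 → Bool × Fin n`, where `L i r = (b, j)`
says that the `r`-th literal of clause `C_i` is `x_j` if `b = true` and `¬x_j` if
`b = false`. Edges: `u_{r,s,i} ~ u_{r',s',i}` for `r ≠ r'`; `v_{b,s,j} ~ v_{b',s',j}`
for `b ≠ b'`; and `u_{r,s,i} ~ v_{b,s',j}` whenever `L i r = (b, j)`. -/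
def satRel (m n : ℕ) (L : Fin m → Fin 3 → Bool × Fin n) :
    SatVert m n → SatVert m n → Prop
  | Sum.inl (r, _, i), Sum.inl (r', _, i') => i = i' ∧ r ≠ r'
  | Sum.inl (r, _, i), Sum.inr (b, _, j) => L i r = (b, j)
  | Sum.inr (b, _, j), Sum.inr (b', _, j') => j = j' ∧ b ≠ b'
  | _, _ => False

/-- The graph `G` of the SAT construction. -/
def satGraph (m n : ℕ) (L : Fin m → Fin 3 → Bool × Fin n) : SimpleGraph (SatVert m n) :=
  SimpleGraph.fromRel (satRel m n L)

/-- `X` is a cluster deletion set of `H`: after deleting `X` there is no induced path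
on three vertices, i.e. any two adjacent edges sharing a middle vertex close into a
triangle. -/
def IsClusterDeletion {α : Type*} (H : SimpleGraph α) (X : Finset α) : Prop :=
  ∀ a b c : α, a ∉ X → b ∉ X → c ∉ X → H.Adj a b → H.Adj b c → a ≠ c → H.Adj a c

/-- `X` is a minimum cluster deletion set of `H`. -/
def IsMinClusterDeletion {α : Type*} (H : SimpleGraph α) (X : Finset α) : Prop :=
  IsClusterDeletion H X ∧ ∀ Y : Finset α, IsClusterDeletion H Y → X.card ≤ Y.card

theorem isClusterDeletion_of_isolated {α : Type*} (H : SimpleGraph α) (X Y : Finset α)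
    (hX : IsClusterDeletion H X)
    (h : ∀ a, a ∉ Y → a ∈ X → ∀ b, H.Adj a b → b ∈ Y) : IsClusterDeletion H Y := by
  have key : ∀ a b, a ∉ Y → b ∉ Y → H.Adj a b → a ∉ X := fun a b ha hb hab haX =>
    hb (h a ha haX b hab)
  intro a b c ha hb hc hab hbc hac
  exact hX a b c (key a b ha hb hab) (key b c hb hc hbc) (key c b hc hb hbc.symm) hab hbc hac

theorem satGraph_adj_inl_inl {m n : ℕ} (L : Fin m → Fin 3 → Bool × Fin n)
    (r r' : Fin 3) (s s' : Fin 7) (i i' : Fin m) :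
    (satGraph m n L).Adj (Sum.inl (r, s, i)) (Sum.inl (r', s', i')) ↔ i = i' ∧ r ≠ r' := by
  simp only [satGraph, SimpleGraph.fromRel_adj, satRel]
  grind

theorem satGraph_adj_inl_inr {m n : ℕ} (L : Fin m → Fin 3 → Bool × Fin n)
    (r : Fin 3) (s : Fin 7) (i : Fin m) (b : Bool) (s' : Fin 3) (j : Fin n) :
    (satGraph m n L).Adj (Sum.inl (r, s, i)) (Sum.inr (b, s', j)) ↔ L i r = (b, j) := by
  simp [satGraph, SimpleGraph.fromRel_adj, satRel]

/-- In the SAT construction, a minimum cluster deletion set contains all vertices of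
exactly two of the three sides of each clause gadget and none of the third side. -/
theorem minClusterDeletion_clause_gadget {m n : ℕ}
    (L : Fin m → Fin 3 → Bool × Fin n) (X : Finset (SatVert m n))
    (hX : IsMinClusterDeletion (satGraph m n L) X) :
    ∀ i : Fin m, ∃ r : Fin 3,
      (∀ s : Fin 7, (Sum.inl (r, s, i) : SatVert m n) ∉ X) ∧
      (∀ r' : Fin 3, r' ≠ r → ∀ s : Fin 7, (Sum.inl (r', s, i) : SatVert m n) ∈ X) := by
  classical
  intro i
  obtain ⟨hC, hmin⟩ := hX
  by_cases hA : ∃ r : Fin 3, ∃ s t : Fin 7, s ≠ t ∧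
      (Sum.inl (r, s, i) : SatVert m n) ∉ X ∧ (Sum.inl (r, t, i) : SatVert m n) ∉ X
  · -- some side has two remaining vertices
    obtain ⟨r, s, t, hst, hs, ht⟩ := hA
    have hne : (Sum.inl (r, s, i) : SatVert m n) ≠ Sum.inl (r, t, i) := by
      simpa using hst
    have hnadj : ¬ (satGraph m n L).Adj (Sum.inl (r, s, i)) (Sum.inl (r, t, i)) := by
      simp [satGraph_adj_inl_inl]
    have hnb : ∀ (x : Fin 7) (w : SatVert m n),
        (satGraph m n L).Adj (Sum.inl (r, x, i)) w → w ∈ X := by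
      intro x w hw
      by_contra hwX
      have same : ∀ y : Fin 7, (satGraph m n L).Adj (Sum.inl (r, y, i)) w := by
        intro y
        rcases w with ⟨r', s', i'⟩ | ⟨b, s', j⟩
        · rw [satGraph_adj_inl_inl] at hw ⊢; exact hw
        · rw [satGraph_adj_inl_inr] at hw ⊢; exact hw
      exact hnadj (hC _ w _ hs hwX ht (same s) (same t).symm hne)
    refine ⟨r, ?_, ?_⟩
    · intro x hx
      have hE : IsClusterDeletion (satGraph m n L) (X.erase (Sum.inl (r, x, i))) := by
        refine isClusterDeletion_of_isolated _ X _ hC ?_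
        intro a ha haX b hab
        have hax : a = Sum.inl (r, x, i) := by
          by_contra hne'
          exact ha (Finset.mem_erase.2 ⟨hne', haX⟩)
        subst hax
        exact Finset.mem_erase.2 ⟨hab.ne', hnb x b hab⟩
      have h1 := hmin _ hE
      have h2 := Finset.card_erase_lt_of_mem hx
      omega
    · intro r' hr' x
      exact hnb s _ ((satGraph_adj_inl_inl L r r' s x i i).2 ⟨rfl, hr'.symm⟩)
  · -- every side has at most one remaining vertex: keep side 0 instead
    exfalso
    let e : Fin 3 → Fin 7 → SatVert m n := fun r s => Sum.inl (r, s, i)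
    let N : Fin 3 → Finset (Fin 7) := fun r => Finset.univ.filter (fun s => e r s ∉ X)
    let P : Finset (Fin 7) := Finset.univ.filter (fun s => e 0 s ∈ X)
    let V : Finset (SatVert m n) :=
      Finset.univ.image (fun s : Fin 3 => Sum.inr ((L i 0).1, s, (L i 0).2))
    have hN : ∀ r, (N r).card ≤ 1 := by
      intro r
      rw [Finset.card_le_one]
      intro a ha b hb
      by_contra hab
      exact hA ⟨r, a, b, hab, (Finset.mem_filter.1 ha).2, (Finset.mem_filter.1 hb).2⟩
    have hP : 6 ≤ P.card := by
      have h := Finset.card_filter_add_card_filter_not (s := (Finset.univ : Finset (Fin 7)))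
        (fun s => e 0 s ∈ X)
      have h0 := hN 0
      simp only [Finset.card_univ, Fintype.card_fin] at h
      change P.card + (N 0).card = 7 at h
      omega
    have hV : V.card ≤ 3 := by
      simpa using (Finset.card_image_le (s := (Finset.univ : Finset (Fin 3)))
        (f := fun s : Fin 3 => (Sum.inr ((L i 0).1, s, (L i 0).2) : SatVert m n)))
    have hinj : Function.Injective (e 0) := by
      intro a b hab
      simpa [e] using hab
    let Y : Finset (SatVert m n) :=
      (X \ P.image (e 0)) ∪ ((N 1).image (e 1) ∪ ((N 2).image (e 2) ∪ V))
    have hYcard : Y.card < X.card := by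
      have h1 : (X \ P.image (e 0)).card + (P.image (e 0)).card = X.card := by
        apply Finset.card_sdiff_add_card_eq_card
        intro a ha
        obtain ⟨s, hs, rfl⟩ := Finset.mem_image.1 ha
        exact (Finset.mem_filter.1 hs).2
      rw [Finset.card_image_of_injective _ hinj] at h1
      have h2 : Y.card ≤ _ := Finset.card_union_le _ _
      have h3 := Finset.card_union_le ((N 1).image (e 1)) ((N 2).image (e 2) ∪ V)
      have h4 := Finset.card_union_le ((N 2).image (e 2)) V
      have h5 := Finset.card_image_le (s := N 1) (f := e 1)
      have h6 := Finset.card_image_le (s := N 2) (f := e 2)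
      have h7 := hN 1
      have h8 := hN 2
      omega
    have hside : ∀ r : Fin 3, r ≠ 0 → ∀ s, e r s ∈ Y := by
      intro r hr s
      by_cases hx : e r s ∈ X
      · refine Finset.mem_union_left _ (Finset.mem_sdiff.2 ⟨hx, ?_⟩)
        intro h
        obtain ⟨t, -, ht⟩ := Finset.mem_image.1 h
        simp [e] at ht
        exact hr ht.1.symm
      · refine Finset.mem_union_right _ ?_
        have hm : s ∈ N r := Finset.mem_filter.2 ⟨Finset.mem_univ _, hx⟩
        have hr12 : r = 1 ∨ r = 2 := by omega
        rcases hr12 with rfl | rfl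
        · exact Finset.mem_union_left _ (Finset.mem_image_of_mem _ hm)
        · exact Finset.mem_union_right _
            (Finset.mem_union_left _ (Finset.mem_image_of_mem _ hm))
    have hY : IsClusterDeletion (satGraph m n L) Y := by
      refine isClusterDeletion_of_isolated _ X _ hC ?_
      intro a ha haX b hab
      have haP : a ∈ P.image (e 0) := by
        by_contra hne
        exact ha (Finset.mem_union_left _ (Finset.mem_sdiff.2 ⟨haX, hne⟩))
      obtain ⟨s, -, rfl⟩ := Finset.mem_image.1 haP
      rcases b with ⟨r', s', i'⟩ | ⟨b, s', j⟩
      · obtain ⟨rfl, hr⟩ := (satGraph_adj_inl_inl L 0 r' s s' i i').1 hab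
        exact hside r' hr.symm s'
      · have hL := (satGraph_adj_inl_inr L 0 s i b s' j).1 hab
        refine Finset.mem_union_right _ (Finset.mem_union_right _ (Finset.mem_union_right _ ?_))
        refine Finset.mem_image.2 ⟨s', Finset.mem_univ _, ?_⟩
        rw [hL]
    have := hmin Y hY
    omega
end

section
/- Let G be the graph produced by the SAT construction below and let X be a minimum cluster deletion set of G. Then for each j ∈ {1, …, n}, X contains all three vertices of at least one of the two sides of the variable gadget for x_j. -/
/-- In the SAT construction, a minimum cluster deletion set contains all three vertices
of at least one of the two sides of each variable gadget. -/
theorem minClusterDeletion_variable_gadget {m n : ℕ}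
    (L : Fin m → Fin 3 → Bool × Fin n) (X : Finset (SatVert m n))
    (hX : IsMinClusterDeletion (satGraph m n L) X) :
    ∀ j : Fin n, ∃ b : Bool, ∀ s : Fin 3, (Sum.inr (b, s, j) : SatVert m n) ∈ X := by
  intro j
  by_contra hcon
  push Not at hcon
  obtain ⟨hC, hmin⟩ := hX
  obtain ⟨p, hp⟩ := hcon true
  obtain ⟨q, hq⟩ := hcon false
  have avv : ∀ (b b' : Bool) (s s' : Fin 3) (k k' : Fin n),
      (satGraph m n L).Adj (Sum.inr (b, s, k)) (Sum.inr (b', s', k')) ↔ k = k' ∧ b ≠ b' := by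
    intro b b' s s' k k'
    simp only [satGraph, SimpleGraph.fromRel_adj, satRel]
    grind
  have auv : ∀ (r : Fin 3) (t : Fin 7) (i : Fin m) (b : Bool) (s : Fin 3) (k : Fin n),
      (satGraph m n L).Adj (Sum.inl (r, t, i)) (Sum.inr (b, s, k)) ↔ L i r = (b, k) := by
    intro r t i b s k
    simp [satGraph, SimpleGraph.fromRel_adj, satRel]
  have hT : ∀ s, s ≠ p → (Sum.inr (true, s, j) : SatVert m n) ∈ X := by
    intro s hs
    by_contra h
    have := hC _ _ _ h hq hp ((avv _ _ _ _ _ _).2 (by simp)) ((avv _ _ _ _ _ _).2 (by simp))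
      (by simpa using hs)
    simp [avv] at this
  have hF : ∀ s, s ≠ q → (Sum.inr (false, s, j) : SatVert m n) ∈ X := by
    intro s hs
    by_contra h
    have := hC _ _ _ h hp hq ((avv _ _ _ _ _ _).2 (by simp)) ((avv _ _ _ _ _ _).2 (by simp))
      (by simpa using hs)
    simp [avv] at this
  have hU : ∀ r t i, L i r = (false, j) → (Sum.inl (r, t, i) : SatVert m n) ∈ X := by
    intro r t i hL
    by_contra h
    have := hC _ _ _ h hq hp ((auv _ _ _ _ _ _).2 hL) ((avv _ _ _ _ _ _).2 (by simp))
      (by simp)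
    simp [auv, hL] at this
  obtain ⟨q1, q2, h1, h2, h12⟩ : ∃ q1 q2 : Fin 3, q1 ≠ q ∧ q2 ≠ q ∧ q1 ≠ q2 := by
    clear hF hq; revert q; decide
  let Y : Finset (SatVert m n) :=
    insert (Sum.inr (true, p, j)) ((X.erase (Sum.inr (false, q1, j))).erase (Sum.inr (false, q2, j)))
  have hnb : ∀ (s : Fin 3) (a : SatVert m n),
      (satGraph m n L).Adj a (Sum.inr (false, s, j)) → a ∈ Y := by
    rintro s (⟨r, t, i⟩ | ⟨b, s', k⟩) ha
    · have := hU r t i ((auv _ _ _ _ _ _).1 ha)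
      simp [Y, this]
    · obtain ⟨rfl, hb⟩ := (avv _ _ _ _ _ _).1 ha
      have hb' : b = true := by simpa using hb
      subst hb'
      by_cases hs : s' = p
      · simp [Y, hs]
      · simp [Y, hT s' hs]
  have hXY : ∀ a, a ∉ Y → (∀ s, a ≠ Sum.inr (false, s, j)) → a ∉ X := by
    intro a ha hs hx
    apply ha
    simp [Y, hs, hx]
  have hY : IsClusterDeletion (satGraph m n L) Y := by
    intro a b c ha hb hc hab hbc hac
    refine hC a b c (hXY a ha ?_) (hXY b hb ?_) (hXY c hc ?_) hab hbc hac
    · rintro s rfl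
      exact hb (hnb s _ hab.symm)
    · rintro s rfl
      exact ha (hnb s _ hab)
    · rintro s rfl
      exact hb (hnb s _ hbc)
  have hle := hmin Y hY
  have e1 := Finset.card_erase_add_one (hF q1 h1)
  have e2 : (Sum.inr (false, q2, j) : SatVert m n) ∈ X.erase (Sum.inr (false, q1, j)) := by
    simp [hF q2 h2, h12.symm]
  have e2 := Finset.card_erase_add_one e2
  have e3 : Y.card ≤ _ := Finset.card_insert_le _ _
  omega
end

section
/- Let G be the graph produced by the SAT construction below. Then every minimum cluster deletion set of G is a vertex cover of G; consequently, cvd(G) = vc(G). -/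
/-- A vertex cover of a graph is a set of vertices containing at least one endpoint of
every edge. -/
def IsVertexCover {α : Type*} (H : SimpleGraph α) (W : Finset α) : Prop :=
  ∀ ⦃u v : α⦄, H.Adj u v → u ∈ W ∨ v ∈ W

open Classical in
/-- Exchange argument: swap the remaining neighbours of `v` for its false twins. -/
lemma twin_exchange {α : Type*} [Fintype α] (H : SimpleGraph α) (X T : Finset α) (v : α)
    (hX : IsMinClusterDeletion H X) (hv : v ∉ X) (hTX : T ⊆ X)
    (hT : ∀ t ∈ T, ∀ w, H.Adj t w ↔ H.Adj v w) :
    T.card ≤ (Finset.univ.filter (fun w => H.Adj v w ∧ w ∉ X)).card := by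
  set N := Finset.univ.filter (fun w => H.Adj v w ∧ w ∉ X) with hN
  have hY : IsClusterDeletion H ((X \ T) ∪ N) := by
    have key : ∀ a b, a ∉ (X \ T) ∪ N → b ∉ (X \ T) ∪ N → H.Adj a b → a ∉ X := by
      intro a b ha hb hab haX
      simp only [hN, Finset.mem_union, Finset.mem_sdiff, Finset.mem_filter, Finset.mem_univ,
        true_and, not_or, not_and, not_not] at ha hb
      have haT := ha.1 haX
      have hvb := (hT a haT b).1 hab
      have hbX := hb.2 hvb
      have hbT := hb.1 hbX
      exact H.loopless.irrefl v ((hT b hbT v).1 hvb.symm)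
    intro a b c ha hb hc hab hbc hac
    exact hX.1 a b c (key a b ha hb hab) (key b a hb ha hab.symm) (key c b hc hb hbc.symm)
      hab hbc hac
  have h1 := hX.2 _ hY
  have h2 := Finset.card_union_le (X \ T) N
  have h3 := Finset.card_sdiff_add_card_eq_card hTX
  omega

/-- The side of a vertex inside its gadget. -/
def satSide {m n : ℕ} : SatVert m n → Fin 3 ⊕ Bool
  | Sum.inl (r, _, _) => Sum.inl r
  | Sum.inr (b, _, _) => Sum.inr b

lemma satSide_ne {m n : ℕ} (L : Fin m → Fin 3 → Bool × Fin n) {x y : SatVert m n}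
    (h : (satGraph m n L).Adj x y) : satSide x ≠ satSide y := by
  rcases x with ⟨r, s, i⟩ | ⟨r, s, i⟩ <;> rcases y with ⟨r', s', i'⟩ | ⟨r', s', i'⟩ <;>
    simp [satGraph, satRel, satSide] at h ⊢ <;> grind

lemma twin_inl {m n : ℕ} (L : Fin m → Fin 3 → Bool × Fin n) (r s s' i) (w : SatVert m n) :
    (satGraph m n L).Adj (Sum.inl (r, s, i)) w ↔ (satGraph m n L).Adj (Sum.inl (r, s', i)) w := by
  rcases w with ⟨r', t, i'⟩ | ⟨r', t, i'⟩ <;> simp [satGraph, satRel] <;> grind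

lemma twin_inr {m n : ℕ} (L : Fin m → Fin 3 → Bool × Fin n) (r s s' i) (w : SatVert m n) :
    (satGraph m n L).Adj (Sum.inr (r, s, i)) w ↔ (satGraph m n L).Adj (Sum.inr (r, s', i)) w := by
  rcases w with ⟨r', t, i'⟩ | ⟨r', t, i'⟩ <;> simp [satGraph, satRel] <;> grind

open Classical in
/-- A remaining vertex with a remaining neighbour and `k` further twins has at least `k`
remaining neighbours. -/
lemma many_neighbours {α : Type*} [Fintype α] (H : SimpleGraph α) (X : Finset α)
    (hX : IsMinClusterDeletion H X) {k : ℕ} (f : Fin (k + 1) → α) (hf : Function.Injective f)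
    (htw : ∀ s s' w, H.Adj (f s) w ↔ H.Adj (f s') w) (s : Fin (k + 1)) (hs : f s ∉ X)
    (w : α) (hw : w ∉ X) (hsw : H.Adj (f s) w) :
    k ≤ (Finset.univ.filter (fun w => H.Adj (f s) w ∧ w ∉ X)).card := by
  have h := twin_exchange H X ((Finset.univ.erase s).image f) (f s) hX hs ?_ ?_
  · rw [Finset.card_image_of_injective _ hf] at h
    simpa using h
  · intro t ht
    simp only [Finset.mem_image, Finset.mem_erase] at ht
    obtain ⟨s', ⟨hne, -⟩, rfl⟩ := ht
    by_contra hc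
    have hadj := hX.1 (f s) w (f s') hs hw hc hsw ((htw s s' w).1 hsw).symm
      (fun e => hne (hf e).symm)
    exact H.loopless.irrefl _ ((htw s s' (f s')).1 hadj)
  · intro t ht w
    simp only [Finset.mem_image, Finset.mem_erase] at ht
    obtain ⟨s', -, rfl⟩ := ht
    exact htw _ _ _

open Classical in
lemma side_injOn {m n : ℕ} (L : Fin m → Fin 3 → Bool × Fin n) (X : Finset (SatVert m n))
    (hX : IsClusterDeletion (satGraph m n L) X) (v : SatVert m n) (hv : v ∉ X) :
    Set.InjOn (satSide (m := m) (n := n)) (((Finset.univ.filter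
      (fun w => (satGraph m n L).Adj v w ∧ w ∉ X)) : Finset (SatVert m n)) :
        Set (SatVert m n)) := by
  intro a ha b hb hab
  simp only [Finset.mem_coe, Finset.mem_filter, Finset.mem_univ, true_and] at ha hb
  by_contra hne
  exact satSide_ne L (hX a v b ha.2 hv hb.2 ha.1.symm hb.1 hne) hab

lemma no_clause_edge {m n : ℕ} (L : Fin m → Fin 3 → Bool × Fin n) (X : Finset (SatVert m n))
    (hX : IsMinClusterDeletion (satGraph m n L) X) (r s i) (w : SatVert m n)
    (hu : Sum.inl (r, s, i) ∉ X) (hw : w ∉ X) :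
    ¬ (satGraph m n L).Adj (Sum.inl (r, s, i)) w := by
  classical
  intro h
  have h1 := many_neighbours (k := 6) (satGraph m n L) X hX (fun s => Sum.inl (r, s, i))
    (by intro a b hab; simpa using hab) (fun s s' w => twin_inl L r s s' i w) s hu w hw h
  have h2 := Finset.card_le_card_of_injOn (t := (Finset.univ : Finset (Fin 3 ⊕ Bool))) satSide
    (by intro x _; simp) (side_injOn L X hX.1 (Sum.inl (r, s, i)) hu)
  simp only [Finset.card_univ, Fintype.card_sum, Fintype.card_fin, Fintype.card_bool] at h2
  have h3 : 6 ≤ 5 := Nat.le_trans h1 (by convert h2)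
  omega

lemma min_isVertexCover {m n : ℕ} (L : Fin m → Fin 3 → Bool × Fin n) (X : Finset (SatVert m n))
    (hX : IsMinClusterDeletion (satGraph m n L) X) : IsVertexCover (satGraph m n L) X := by
  classical
  intro u w h
  by_contra hc
  obtain ⟨hu, hw⟩ := not_or.1 hc
  rcases u with ⟨r, s, i⟩ | ⟨b, s, j⟩
  · exact no_clause_edge L X hX r s i w hu hw h
  have h1 := many_neighbours (k := 2) (satGraph m n L) X hX (fun s => Sum.inr (b, s, j))
    (by intro a b hab; simpa using hab) (fun s s' w => twin_inr L b s s' j w) s hu w hw h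
  have h2 := Finset.card_le_card_of_injOn (t := ({Sum.inr (!b)} : Finset (Fin 3 ⊕ Bool))) satSide
    (by
      intro x hx
      simp only [Finset.mem_coe, Finset.mem_filter, Finset.mem_univ, true_and] at hx
      have hne := satSide_ne L hx.1
      rcases x with ⟨r', s', i'⟩ | ⟨b', s', j'⟩
      · exact absurd hx.1.symm (no_clause_edge L X hX r' s' i' _ hx.2 hu)
      · simp [satSide] at hne ⊢
        cases b <;> cases b' <;> simp_all)
    (side_injOn L X hX.1 (Sum.inr (b, s, j)) hu)
  simp only [Finset.card_singleton] at h2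
  have h3 : 2 ≤ 1 := Nat.le_trans h1 (by convert h2)
  omega

/-- In the SAT construction, every minimum cluster deletion set of `G` is a vertex
cover of `G`; consequently the cluster deletion number of `G` equals its vertex cover
number. -/
theorem minClusterDeletion_isVertexCover {m n : ℕ}
    (L : Fin m → Fin 3 → Bool × Fin n) :
    (∀ X : Finset (SatVert m n), IsMinClusterDeletion (satGraph m n L) X →
        IsVertexCover (satGraph m n L) X) ∧
      sInf {c : ℕ | ∃ X : Finset (SatVert m n),
          X.card = c ∧ IsClusterDeletion (satGraph m n L) X} =
        sInf {c : ℕ | ∃ W : Finset (SatVert m n),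
          W.card = c ∧ IsVertexCover (satGraph m n L) W} := by
  refine ⟨fun X hX => min_isVertexCover L X hX, ?_⟩
  apply le_antisymm
  · have hne : {c : ℕ | ∃ W : Finset (SatVert m n),
          W.card = c ∧ IsVertexCover (satGraph m n L) W}.Nonempty :=
      ⟨_, Finset.univ, rfl, fun u v _ => Or.inl (Finset.mem_univ u)⟩
    obtain ⟨W, hW, hc⟩ := Nat.sInf_mem hne
    rw [← hW]
    refine Nat.sInf_le ⟨W, rfl, ?_⟩
    intro a b c ha hb _ hab _ _
    exact absurd (hc hab) (by tauto)
  · have hne : {c : ℕ | ∃ X : Finset (SatVert m n),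
          X.card = c ∧ IsClusterDeletion (satGraph m n L) X}.Nonempty :=
      ⟨_, Finset.univ, rfl, fun a _ _ ha => absurd (Finset.mem_univ a) ha⟩
    obtain ⟨X, hX, hc⟩ := Nat.sInf_mem hne
    have hmin : IsMinClusterDeletion (satGraph m n L) X :=
      ⟨hc, fun Y hY => by rw [hX]; exact Nat.sInf_le ⟨Y, rfl, hY⟩⟩
    rw [← hX]
    exact Nat.sInf_le ⟨X, rfl, min_isVertexCover L X hmin⟩
end

section
/- Let φ be a Boolean formula in 3-CNF with m clauses (each with exactly three literals) over n variables, and let G be the graph produced by the SAT construction below. Then φ is satisfiable if and only if G has a vertex cover of size at most 14m + 3n. -/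
theorem satCard {m n : ℕ} (W : Finset (SatVert m n)) :
    W.card = ∑ i : Fin m, ∑ r : Fin 3, ∑ s : Fin 7, (if Sum.inl (r, s, i) ∈ W then 1 else 0)
      + ∑ j : Fin n, ∑ b : Bool, ∑ s : Fin 3, (if Sum.inr (b, s, j) ∈ W then 1 else 0) := by
  have h : W.card = ∑ x : SatVert m n, (if x ∈ W then 1 else 0) := by simp
  rw [h, Fintype.sum_sum_type]
  simp only [Fintype.sum_prod_type]
  congr 1
  · rw [Finset.sum_comm]
    rw [Finset.sum_comm]
    rw [Finset.sum_comm (s := (Finset.univ : Finset (Fin m)))]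
    exact Finset.sum_congr rfl fun r _ => Finset.sum_comm
  · rw [Finset.sum_comm (s := (Finset.univ : Finset (Fin n)))]
    exact Finset.sum_congr rfl fun r _ => Finset.sum_comm

theorem sum_ind_le {k : ℕ} (P : Fin k → Prop) [DecidablePred P] :
    (∑ s : Fin k, (if P s then 1 else 0)) ≤ k := by
  have := Finset.card_le_univ (Finset.univ.filter P)
  simpa using this

theorem sum_ind_full {k : ℕ} (P : Fin k → Prop) [DecidablePred P] (h : ∀ s, P s) :
    (∑ s : Fin k, (if P s then 1 else 0)) = k := by
  simp [h]

/-- The 3-CNF formula encoded by `L` is satisfiable iff the graph of the SAT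
construction has a vertex cover of size at most `14m + 3n`. -/
theorem satisfiable_iff_satGraph_vertexCover {m n : ℕ}
    (L : Fin m → Fin 3 → Bool × Fin n) :
    (∃ α : Fin n → Bool, ∀ i : Fin m, ∃ r : Fin 3, α (L i r).2 = (L i r).1) ↔
      (∃ W : Finset (SatVert m n), W.card ≤ 14 * m + 3 * n ∧
        ∀ ⦃u v : SatVert m n⦄, (satGraph m n L).Adj u v → u ∈ W ∨ v ∈ W) := by
  constructor
  · rintro ⟨α, hα⟩
    choose f hf using hα
    refine ⟨Finset.univ.filter (fun x => (match x with
      | Sum.inl (r, _, i) => decide (r ≠ f i)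
      | Sum.inr (b, _, j) => decide (b = α j)) = true), ?_, ?_⟩
    · rw [satCard]
      apply le_of_eq
      simp only [Finset.mem_filter, Finset.mem_univ, true_and, decide_eq_true_eq]
      congr 1
      · have : ∀ i : Fin m, (∑ r : Fin 3, ∑ s : Fin 7, (if r ≠ f i then 1 else 0)) = 14 := by
          intro i
          generalize f i = a
          revert a
          decide
        rw [Finset.sum_congr rfl fun i _ => this i]
        simp [mul_comm]
      · have : ∀ j : Fin n, (∑ b : Bool, ∑ s : Fin 3, (if b = α j then 1 else 0)) = 3 := by
          intro j
          generalize α j = a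
          revert a
          decide
        rw [Finset.sum_congr rfl fun i _ => this i]
        simp [mul_comm]
    · rintro (⟨r, s, i⟩ | ⟨b, s, j⟩) (⟨r', s', i'⟩ | ⟨b', s', j'⟩) h <;>
        simp only [satGraph, SimpleGraph.fromRel_adj, satRel, Finset.mem_filter,
          Finset.mem_univ, true_and, decide_eq_true_eq] at h ⊢
      · grind
      · by_cases hr : r = f i
        · right
          have := hf i
          grind
        · left; exact hr
      · by_cases hr : r' = f i'
        · left
          have := hf i'
          grind
        · right; exact hr
      · cases b <;> cases b' <;> cases hh : α j <;> grind
  · rintro ⟨W, hW, hcov⟩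
    rw [satCard] at hW
    set c : Fin m → Fin 3 → ℕ := fun i r =>
      ∑ s : Fin 7, (if Sum.inl (r, s, i) ∈ W then 1 else 0) with hc
    set d : Fin n → Bool → ℕ := fun j b =>
      ∑ s : Fin 3, (if Sum.inr (b, s, j) ∈ W then 1 else 0) with hd
    change ∑ i, ∑ r, c i r + ∑ j, ∑ b, d j b ≤ _ at hW
    have cle : ∀ i r, c i r ≤ 7 := fun i r => sum_ind_le _
    have cfull : ∀ i r, (∀ s, Sum.inl (r, s, i) ∈ W) → c i r = 7 := fun i r h =>
      sum_ind_full (fun s => Sum.inl (r, s, i) ∈ W) h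
    have dfull : ∀ j b, (∀ s, Sum.inr (b, s, j) ∈ W) → d j b = 3 := fun j b h =>
      sum_ind_full (fun s => Sum.inr (b, s, j) ∈ W) h
    have cc : ∀ i r r', r ≠ r' → c i r = 7 ∨ c i r' = 7 := by
      intro i r r' hr
      by_contra! hcon
      have h1 := mt (cfull i r) hcon.1
      have h2 := mt (cfull i r') hcon.2
      push Not at h1 h2
      obtain ⟨s, hs⟩ := h1
      obtain ⟨s', hs'⟩ := h2
      have := @hcov (Sum.inl (r, s, i)) (Sum.inl (r', s', i)) (by
        simp [satGraph, satRel, hr])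
      tauto
    have dd : ∀ j, d j true = 3 ∨ d j false = 3 := by
      intro j
      by_contra! hcon
      have h1 := mt (dfull j true) hcon.1
      have h2 := mt (dfull j false) hcon.2
      push Not at h1 h2
      obtain ⟨s, hs⟩ := h1
      obtain ⟨s', hs'⟩ := h2
      have := @hcov (Sum.inr (true, s, j)) (Sum.inr (false, s', j)) (by
        simp [satGraph, satRel])
      tauto
    have c14 : ∀ i, 14 ≤ ∑ r, c i r := by
      intro i
      have h1 := cc i 0 1 (by decide)
      have h2 := cc i 0 2 (by decide)
      have h3 := cc i 1 2 (by decide)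
      rw [Fin.sum_univ_three]
      omega
    have d3 : ∀ j, 3 ≤ ∑ b, d j b := by
      intro j
      have h1 := dd j
      rw [Fintype.sum_bool]
      omega
    have sc : ∑ i : Fin m, 14 ≤ ∑ i, ∑ r, c i r := Finset.sum_le_sum fun i _ => c14 i
    have sd : ∑ j : Fin n, 3 ≤ ∑ j, ∑ b, d j b := Finset.sum_le_sum fun j _ => d3 j
    have e1 : ∑ i : Fin m, 14 = 14 * m := by simp [mul_comm]
    have e2 : ∑ j : Fin n, 3 = 3 * n := by simp [mul_comm]
    have ceq : ∀ i, 14 = ∑ r, c i r := fun i =>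
      (Finset.sum_eq_sum_iff_of_le fun i _ => c14 i).1 (by omega) i (Finset.mem_univ i)
    have deq : ∀ j, 3 = ∑ b, d j b := fun j =>
      (Finset.sum_eq_sum_iff_of_le fun j _ => d3 j).1 (by omega) j (Finset.mem_univ j)
    refine ⟨fun j => decide (d j true = 3), fun i => ?_⟩
    have hex : ∃ r, c i r ≠ 7 := by
      by_contra! hcon
      have := ceq i
      simp [hcon] at this
    obtain ⟨r, hr⟩ := hex
    have hr' := mt (cfull i r) hr
    push Not at hr'
    obtain ⟨s, hs⟩ := hr'
    refine ⟨r, ?_⟩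
    have hfull : d (L i r).2 (L i r).1 = 3 := by
      apply dfull
      intro s'
      have := @hcov (Sum.inl (r, s, i)) (Sum.inr ((L i r).1, s', (L i r).2)) (by
        simp [satGraph, satRel])
      tauto
    have h3 := deq (L i r).2
    rw [Fintype.sum_bool] at h3
    cases hb : (L i r).1 with
    | true => rw [hb] at hfull; simpa using hfull
    | false =>
      rw [hb] at hfull
      have : d (L i r).2 true ≠ 3 := by omega
      simpa using this
end

section
/- In the construction below, the vertex cover number of H equals |V(G)|, i.e., vc(H) = |V(G)|. -/
/-- Base relation of the construction (symmetrized by `SimpleGraph.fromRel`):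
`H` consists of a copy of `G` (`Sum.inl`), a pendant leaf `u_v = Sum.inr (Sum.inl v)`
attached to each vertex `v` of `G`, and a set `V*` of `lam` pairwise nonadjacent
vertices (`Sum.inr (Sum.inr _)`) each adjacent to every vertex of the copy of `G`. -/
def belowVCRel {V : Type*} (G : SimpleGraph V) (lam : ℕ) :
    (V ⊕ V ⊕ Fin lam) → (V ⊕ V ⊕ Fin lam) → Prop
  | Sum.inl u, Sum.inl v => G.Adj u v
  | Sum.inl v, Sum.inr (Sum.inl u) => v = u
  | Sum.inl _, Sum.inr (Sum.inr _) => True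
  | _, _ => False

/-- The graph `H` of the construction. -/
def belowVCGraph {V : Type*} (G : SimpleGraph V) (lam : ℕ) :
    SimpleGraph (V ⊕ V ⊕ Fin lam) :=
  SimpleGraph.fromRel (belowVCRel G lam)

/-- In the construction (with `λ = |V(G)| − k − 2`), the vertex cover number of `H`
equals `|V(G)|`. -/
theorem belowVCGraph_vcNum {V : Type*} [Fintype V] [DecidableEq V]
    (G : SimpleGraph V) (hedge : ∃ u v : V, G.Adj u v)
    (k : ℕ) (hk : k + 2 ≤ Fintype.card V) :
    sInf {c : ℕ | ∃ W : Finset (V ⊕ V ⊕ Fin (Fintype.card V - k - 2)),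
        W.card = c ∧ ∀ ⦃x y⦄, (belowVCGraph G (Fintype.card V - k - 2)).Adj x y →
          x ∈ W ∨ y ∈ W} = Fintype.card V := by
  generalize Fintype.card V - k - 2 = lam
  apply le_antisymm
  · apply Nat.sInf_le
    refine ⟨Finset.univ.map ⟨Sum.inl, Sum.inl_injective⟩, by simp, ?_⟩
    intro x y h
    rcases x with x | x | x <;> rcases y with y | y | y <;>
      simp [belowVCGraph, belowVCRel] at h ⊢
  · apply le_csInf
    · exact ⟨_, Finset.univ, rfl, fun x y _ => Or.inl (Finset.mem_univ x)⟩
    · rintro c ⟨W, rfl, hW⟩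
      have hv : ∀ v : V, (Sum.inl v : V ⊕ V ⊕ Fin lam) ∈ W ∨ Sum.inr (Sum.inl v) ∈ W := by
        intro v
        apply hW
        simp [belowVCGraph, belowVCRel]
      let f : V → V ⊕ V ⊕ Fin lam := fun v =>
        if (Sum.inl v : V ⊕ V ⊕ Fin lam) ∈ W then Sum.inl v else Sum.inr (Sum.inl v)
      have hf : ∀ v, f v ∈ W := by
        intro v
        by_cases h : (Sum.inl v : V ⊕ V ⊕ Fin lam) ∈ W
        · simp [f, h]
        · simpa [f, h] using (hv v).resolve_left h
      have hinj : Function.Injective f := by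
        intro a b hab
        simp only [f] at hab
        split_ifs at hab <;> simpa using hab
      rw [← Finset.card_univ]
      exact Finset.card_le_card_of_injOn f (fun v _ => hf v) hinj.injOn
end

section
/- In the construction below, H has a feedback vertex set of size at most |V(G)| − 2 if and only if G has a feedback vertex set of size at most k. -/
theorem acyclic_of_pendant {W : Type*} (G : SimpleGraph W) (T : Set W)
    (hT : (G.induce T).IsAcyclic)
    (h : ∀ x, x ∉ T → ∀ y z, G.Adj x y → G.Adj x z → y = z) : G.IsAcyclic := by
  classical
  intro v c hc
  have hs : ∀ x ∈ c.support, x ∈ T := by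
    intro x hx
    by_contra hxT
    have hr := hc.rotate hx
    exact hr.snd_ne_penultimate (h x hxT _ _ ((c.rotate x hx).adj_snd hr.not_nil)
      ((c.rotate x hx).adj_penultimate hr.not_nil).symm)
  refine hT (c.induce T hs) ?_
  have := SimpleGraph.Walk.map_induce c hs
  rw [← SimpleGraph.Walk.isCycle_map_iff_of_injective
    (f := (SimpleGraph.Embedding.induce T).toHom) Subtype.val_injective, this]
  exact hc

theorem acyclic_no_triangle {W : Type*} {G : SimpleGraph W} (hG : G.IsAcyclic) {a b c : W}
    (h1 : G.Adj a b) (h2 : G.Adj b c) (h3 : G.Adj a c) : False := by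
  have := hG.path_unique (⟨.cons h1 (.cons h2 .nil), by
      simp [h1.ne, h2.ne, h3.ne]⟩ : G.Path a c) ⟨.cons h3 .nil, by simp [h3.ne]⟩
  have := congrArg (fun p : G.Path a c => p.1.length) this
  simp at this

theorem acyclic_no_square {W : Type*} {G : SimpleGraph W} (hG : G.IsAcyclic) {a b c d : W}
    (h1 : G.Adj a b) (h2 : G.Adj b c) (h3 : G.Adj a d) (h4 : G.Adj d c)
    (hac : a ≠ c) (hbd : b ≠ d) : False := by
  have := hG.path_unique (⟨.cons h1 (.cons h2 .nil), by
      simp [h1.ne, h2.ne, hac]⟩ : G.Path a c)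
      ⟨.cons h3 (.cons h4 .nil), by simp [h3.ne, h4.ne, hac]⟩
  have := congrArg (fun p : G.Path a c => p.1.snd) this
  simp at this
  exact hbd this

theorem belowVC_adj_inl {V : Type*} (G : SimpleGraph V) (lam : ℕ) (u v : V) :
    (belowVCGraph G lam).Adj (Sum.inl u) (Sum.inl v) ↔ G.Adj u v := by
  simp only [belowVCGraph, SimpleGraph.fromRel_adj, belowVCRel, ne_eq, Sum.inl.injEq]
  exact ⟨fun h => h.2.elim id fun h => h.symm, fun h => ⟨h.ne, Or.inl h⟩⟩

theorem belowVC_adj_star {V : Type*} (G : SimpleGraph V) (lam : ℕ) (u : V) (i : Fin lam) :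
    (belowVCGraph G lam).Adj (Sum.inl u) (Sum.inr (Sum.inr i)) := by
  simp [belowVCGraph, SimpleGraph.fromRel_adj, belowVCRel]

theorem belowVC_adj_leaf {V : Type*} (G : SimpleGraph V) (lam : ℕ) (u : V)
    (y : V ⊕ V ⊕ Fin lam) (h : (belowVCGraph G lam).Adj (Sum.inr (Sum.inl u)) y) :
    y = Sum.inl u := by
  rcases y with v | v | i <;>
    simp [belowVCGraph, SimpleGraph.fromRel_adj, belowVCRel] at h ⊢
  exact h

/-- In the construction (with `λ = |V(G)| − k − 2`), the graph `H` has a feedback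
vertex set of size at most `|V(G)| − 2` iff `G` has a feedback vertex set of size at
most `k`. -/
theorem belowVCGraph_fvs_iff {V : Type*} [Fintype V] [DecidableEq V]
    (G : SimpleGraph V) (hedge : ∃ u v : V, G.Adj u v)
    (k : ℕ) (hk : k + 2 ≤ Fintype.card V) :
    (∃ X : Finset (V ⊕ V ⊕ Fin (Fintype.card V - k - 2)),
        X.card ≤ Fintype.card V - 2 ∧
        ((belowVCGraph G (Fintype.card V - k - 2)).induce {x | x ∉ X}).IsAcyclic) ↔
      (∃ S : Finset V, S.card ≤ k ∧ (G.induce {v | v ∉ S}).IsAcyclic) := by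
  generalize hl : Fintype.card V - k - 2 = lam
  constructor
  · rintro ⟨X, hX, hac⟩
    set A : Finset V := Finset.univ.filter (fun v => Sum.inl v ∈ X) with hA
    set B : Finset (Fin lam) := Finset.univ.filter (fun i => Sum.inr (Sum.inr i) ∈ X) with hB
    have hAB : A.card + B.card ≤ X.card := by
      rw [← Finset.card_disjSum]
      refine Finset.card_le_card_of_injOn (Sum.map id Sum.inr) ?_ ?_
      · intro x hx
        rcases x with v | i <;> simpa [hA, hB] using hx
      · exact (Function.Injective.sumMap Function.injective_id Sum.inr_injective).injOn
    have hAac : (G.induce {v | v ∉ A}).IsAcyclic := by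
      refine hac.comap ⟨fun v => ⟨Sum.inl v.1, by simpa [hA] using v.2⟩, ?_⟩ ?_
      · intro a b hab
        simpa [belowVC_adj_inl] using hab
      · intro a b hab
        simpa [Subtype.ext_iff] using hab
    by_cases hAk : A.card ≤ k
    · exact ⟨A, hAk, hAac⟩
    have hBlt : B.card < lam := by omega
    have hA2 : A.card ≤ Fintype.card V - 2 := by omega
    have hcA : 1 < Aᶜ.card := by rw [Finset.card_compl]; omega
    obtain ⟨r, hr, s, hs, hrs⟩ := Finset.one_lt_card.1 hcA
    have hrX : Sum.inl r ∉ X := by simpa [hA] using hr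
    have hsX : Sum.inl s ∉ X := by simpa [hA] using hs
    have hcB : Bᶜ.card ≤ 1 := by
      rw [Finset.card_le_one]
      intro i hi j hj
      by_contra hij
      have hiX : Sum.inr (Sum.inr i) ∉ X := by simpa [hB] using hi
      have hjX : Sum.inr (Sum.inr j) ∉ X := by simpa [hB] using hj
      refine acyclic_no_square hac (a := ⟨_, hrX⟩) (b := ⟨_, hiX⟩) (c := ⟨_, hsX⟩)
        (d := ⟨_, hjX⟩) (belowVC_adj_star ..) (belowVC_adj_star ..).symm
        (belowVC_adj_star ..) (belowVC_adj_star ..).symm ?_ ?_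
      · simpa using hrs
      · simpa using hij
    have hcB0 : 0 < Bᶜ.card := by rw [Finset.card_compl, Fintype.card_fin]; omega
    obtain ⟨w, hw⟩ := Finset.card_pos.1 hcB0
    have hwX : Sum.inr (Sum.inr w) ∉ X := by simpa [hB] using hw
    rw [Finset.card_compl, Fintype.card_fin] at hcB
    obtain ⟨a, ha⟩ : A.Nonempty := Finset.card_pos.1 (by omega)
    have hind : ∀ u v, u ∉ A → v ∉ A → ¬ G.Adj u v := by
      intro u v hu hv huv
      have huX : Sum.inl u ∉ X := by simpa [hA] using hu
      have hvX : Sum.inl v ∉ X := by simpa [hA] using hv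
      exact acyclic_no_triangle hac (a := ⟨_, huX⟩) (b := ⟨_, hvX⟩) (c := ⟨_, hwX⟩)
        ((belowVC_adj_inl ..).2 huv) (belowVC_adj_star ..) (belowVC_adj_star ..)
    refine ⟨A.erase a, by rw [Finset.card_erase_of_mem ha]; omega, ?_⟩
    have hnb : ∀ x y : {v // v ∉ A.erase a}, x.1 ≠ a → G.Adj x.1 y.1 → y.1 = a := by
      intro x y hx hxy
      by_contra hy
      exact hind _ _ (fun h => x.2 (Finset.mem_erase.2 ⟨hx, h⟩))
        (fun h => y.2 (Finset.mem_erase.2 ⟨hy, h⟩)) hxy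
    refine acyclic_of_pendant _ {x | x.1 = a} ?_ ?_
    · have : Subsingleton {x : {v // v ∈ {v | v ∉ A.erase a}} | x.1 = a} :=
        ⟨fun x y => Subtype.ext (Subtype.ext (x.2.trans y.2.symm))⟩
      exact SimpleGraph.IsAcyclic.of_subsingleton
    · intro x hx y z hy hz
      exact Subtype.ext ((hnb x y hx hy).trans (hnb x z hx hz).symm)
  · rintro ⟨S, hS, hac⟩
    refine ⟨S.disjSum ((∅ : Finset V).disjSum Finset.univ), ?_, ?_⟩
    · simp only [Finset.card_disjSum, Finset.card_empty, Finset.card_univ, Fintype.card_fin]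
      omega
    refine acyclic_of_pendant _ {x | ∃ v, x.1 = Sum.inl v} ?_ ?_
    · choose g hg using fun x : {x : {x // x ∈ {x | x ∉ S.disjSum ((∅ : Finset V).disjSum
        (Finset.univ : Finset (Fin lam)))}} | ∃ v, x.1 = Sum.inl v} => x.2
      have hgS : ∀ x, g x ∉ S := by
        intro x
        have := x.1.2
        rw [hg x] at this
        simpa using this
      refine hac.comap ⟨fun x => ⟨g x, hgS x⟩, ?_⟩ ?_
      · intro x y hxy
        have hxy' : (belowVCGraph G lam).Adj x.1.1 y.1.1 := hxy
        rw [hg x, hg y, belowVC_adj_inl] at hxy'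
        exact hxy'
      · intro x y hxy
        have hxy' : g x = g y := congrArg Subtype.val hxy
        exact Subtype.ext (Subtype.ext (by rw [hg x, hg y, hxy']))
    · rintro ⟨x, hx⟩ hxT y z hy hz
      rcases x with v | v | i
      · exact absurd ⟨v, rfl⟩ hxT
      · exact Subtype.ext ((belowVC_adj_leaf _ _ _ _ hy).trans (belowVC_adj_leaf _ _ _ _ hz).symm)
      · simp at hx
end
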